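/- arXiv:1211.0610 — 2 statements merged into one kernel-verified Lean document; each statement's English description precedes it below -/
import Mathlib

section
/- Let d be a positive integer and σ > 0. Let Q₁, Q₂ be symmetric real d×d matrices such that Q₁, Q₂ and Q₂ − Q₁ are invertible, let r₁, r₂, θ₀ ∈ ℝ^d, and set r̃₁ = Q₁θ₀ + σr₁ and r̃₂ = Q₂θ₀ + σr₂. Then −r̃₂ᵗQ₂⁻¹r̃₂ + r̃₁ᵗQ₁⁻¹r̃₁ + (r̃₂ − r̃₁)ᵗ(Q₂ − Q₁)⁻¹(r̃₂ − r̃₁) = σ²·(−r₂ᵗQ₂⁻¹r₂ + r₁ᵗQ₁⁻¹r₁ + (r₂ − r₁)ᵗ(Q₂ − Q₁)⁻¹(r₂ − r₁)); in particular all terms involving the true parameter θ₀ cancel. -/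
open Matrix

/-- The quadratic form of `Q⁻¹` at `Q *ᵥ θ + c • r`, for a symmetric invertible matrix `Q`. -/
theorem Matrix.IsSymm.dotProduct_inv_mulVec_mulVec_add_smul {n R : Type*} [Fintype n]
    [DecidableEq n] [CommRing R] {Q : Matrix n n R} (hQ : Q.IsSymm) (hdet : IsUnit Q.det)
    (θ r : n → R) (c : R) :
    (Q *ᵥ θ + c • r) ⬝ᵥ (Q⁻¹ *ᵥ (Q *ᵥ θ + c • r))
      = θ ⬝ᵥ (Q *ᵥ θ) + 2 * c * (θ ⬝ᵥ r) + c ^ 2 * (r ⬝ᵥ (Q⁻¹ *ᵥ r)) := by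
  have hinv : Q⁻¹ *ᵥ (Q *ᵥ θ) = θ := by
    rw [mulVec_mulVec, nonsing_inv_mul _ hdet, one_mulVec]
  have hcross : (Q *ᵥ θ) ⬝ᵥ (Q⁻¹ *ᵥ r) = θ ⬝ᵥ r := by
    rw [← hQ.eq, mulVec_transpose, ← dotProduct_mulVec, hQ.eq, mulVec_mulVec,
      mul_nonsing_inv _ hdet, one_mulVec]
  simp only [mulVec_add, mulVec_smul, hinv, add_dotProduct, dotProduct_add, smul_dotProduct,
    dotProduct_smul, hcross, smul_eq_mul, dotProduct_comm (Q *ᵥ θ) θ, dotProduct_comm r θ]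
  ring

/-- the algebraic cancellation of the true parameter `θ₀` in the
log-transformed generalized likelihood ratio statistic. -/
theorem stmt1 (d : ℕ) (hd : 0 < d) (σ : ℝ) (hσ : 0 < σ)
    (Q₁ Q₂ : Matrix (Fin d) (Fin d) ℝ)
    (hQ₁sym : Q₁.IsSymm) (hQ₂sym : Q₂.IsSymm)
    (hQ₁ : IsUnit Q₁.det) (hQ₂ : IsUnit Q₂.det) (hQ₂₁ : IsUnit (Q₂ - Q₁).det)
    (r₁ r₂ θ₀ : Fin d → ℝ)
    (rt₁ rt₂ : Fin d → ℝ)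
    (hrt₁ : rt₁ = Q₁ *ᵥ θ₀ + σ • r₁) (hrt₂ : rt₂ = Q₂ *ᵥ θ₀ + σ • r₂) :
    - (rt₂ ⬝ᵥ (Q₂⁻¹ *ᵥ rt₂)) + rt₁ ⬝ᵥ (Q₁⁻¹ *ᵥ rt₁)
      + (rt₂ - rt₁) ⬝ᵥ ((Q₂ - Q₁)⁻¹ *ᵥ (rt₂ - rt₁))
    = σ ^ 2 * (- (r₂ ⬝ᵥ (Q₂⁻¹ *ᵥ r₂)) + r₁ ⬝ᵥ (Q₁⁻¹ *ᵥ r₁)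
      + (r₂ - r₁) ⬝ᵥ ((Q₂ - Q₁)⁻¹ *ᵥ (r₂ - r₁))) := by
  have hdiff : rt₂ - rt₁ = (Q₂ - Q₁) *ᵥ θ₀ + σ • (r₂ - r₁) := by
    rw [hrt₁, hrt₂, sub_mulVec, smul_sub]
    abel
  rw [hdiff, hrt₁, hrt₂, hQ₁sym.dotProduct_inv_mulVec_mulVec_add_smul hQ₁,
    hQ₂sym.dotProduct_inv_mulVec_mulVec_add_smul hQ₂,
    (hQ₂sym.sub hQ₁sym).dotProduct_inv_mulVec_mulVec_add_smul hQ₂₁,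
    sub_mulVec, dotProduct_sub, dotProduct_sub]
  ring
end

section
/- Let E be a real normed vector space, let Σ ∈ E, and let f : [0,∞) → E be a function that is bounded on every bounded interval [0, T₀] and satisfies ‖(1/T)·f(T) − Σ‖ → 0 as T → ∞. Then sup_{s ∈ [0,1]} ‖(1/T)·f(sT) − s·Σ‖ → 0 as T → ∞. -/
open Filter

/-- if `f` is bounded on bounded intervals of `[0,∞)` and
`(1/T)·f(T) → S` as `T → ∞`, then `(1/T)·f(sT) → s·S` uniformly in `s ∈ [0,1]`. -/
theorem stmt2 {E : Type*} [NormedAddCommGroup E] [NormedSpace ℝ E]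
    (S : E) (f : ℝ → E)
    (hbdd : ∀ T₀ : ℝ, 0 ≤ T₀ → ∃ B : ℝ, ∀ t : ℝ, 0 ≤ t → t ≤ T₀ → ‖f t‖ ≤ B)
    (hlim : Tendsto (fun T : ℝ => ‖(1 / T) • f T - S‖) atTop (nhds 0)) :
    Tendsto (fun T : ℝ =>
        ⨆ s : Set.Icc (0 : ℝ) 1, ‖(1 / T) • f ((s : ℝ) * T) - (s : ℝ) • S‖)
      atTop (nhds 0) := by
  rw [Metric.tendsto_nhds]
  intro ε hε
  have hev : ∀ᶠ t : ℝ in atTop, ‖(1 / t) • f t - S‖ < ε / 2 :=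
    hlim.eventually_lt_const (half_pos hε)
  obtain ⟨T₀, hT₀⟩ := eventually_atTop.1 (hev.and (eventually_gt_atTop 0))
  have hT₀pos : 0 < T₀ := (hT₀ T₀ le_rfl).2
  obtain ⟨B, hB⟩ := hbdd T₀ hT₀pos.le
  filter_upwards [eventually_gt_atTop 0,
    eventually_ge_atTop ((B + T₀ * ‖S‖) / (ε / 2))] with T hT hTB
  rw [div_le_iff₀ (half_pos hε)] at hTB
  have hdev : ∀ t : ℝ, 0 ≤ t → t ≤ T → ‖f t - t • S‖ ≤ T * (ε / 2) := by
    intro t ht htT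
    rcases le_total t T₀ with h | h
    · calc ‖f t - t • S‖ ≤ ‖f t‖ + ‖t • S‖ := norm_sub_le _ _
        _ = ‖f t‖ + t * ‖S‖ := by rw [norm_smul, Real.norm_of_nonneg ht]
        _ ≤ B + T₀ * ‖S‖ := by gcongr; exact hB t ht h
        _ ≤ T * (ε / 2) := hTB
    · obtain ⟨hlt, htpos⟩ := hT₀ t h
      have heq : f t - t • S = t • ((1 / t) • f t - S) := by
        rw [smul_sub, smul_smul, mul_one_div_cancel htpos.ne', one_smul]
      rw [heq, norm_smul, Real.norm_of_nonneg ht]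
      gcongr
  have hsup : (⨆ s : Set.Icc (0 : ℝ) 1,
      ‖(1 / T) • f ((s : ℝ) * T) - (s : ℝ) • S‖) ≤ ε / 2 := by
    refine ciSup_le fun s => ?_
    have heq : (1 / T) • f ((s : ℝ) * T) - (s : ℝ) • S =
        (1 / T) • (f ((s : ℝ) * T) - ((s : ℝ) * T) • S) := by
      rw [smul_sub, smul_smul]
      congr 2
      field_simp
    rw [heq, norm_smul, Real.norm_of_nonneg (one_div_pos.2 hT).le, one_div,
      inv_mul_le_iff₀ hT]
    exact hdev _ (mul_nonneg s.2.1 hT.le) (mul_le_of_le_one_left hT.le s.2.2)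
  rw [Real.dist_0_eq_abs, abs_of_nonneg (Real.iSup_nonneg fun _ => norm_nonneg _)]
  linarith
end
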